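/- Vanishing of the affine coefficients under detailed balance: if in addition there exists π : X → ℝ with π(x) > 0 for all x and π(u)·r_{0,0}(u,v) = π(v)·r_{0,0}(v,u) for all u, v ∈ X (detailed balance of the reduced graph), then for every ordered pair e = (u,v) of distinct vertices there exists a real number λ¹_e, independent of p and m, such that j_e(p,m) = λ¹_e · j_1(p,m) for all p, m ≥ 0. -/

import Mathlib

open scoped Classical

noncomputable section

/-- A rooted spanning tree with root `x`: a map `t : X → X` fixing `x` such that every
vertex reaches `x` under iteration of `t`. -/
def IsRootedTree {X : Type*} (x : X) (t : X → X) : Prop :=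
  t x = x ∧ ∀ y : X, ∃ n : ℕ, t^[n] y = x

/-- The edge set of a rooted spanning tree: `{(y, t y) : y ≠ x}`. -/
def treeEdges {X : Type*} (x : X) (t : X → X) : Set (X × X) :=
  {p : X × X | p.1 ≠ x ∧ p.2 = t p.1}

/-- The weight of a rooted spanning tree: `∏_{y ≠ x} r (y, t y)`. -/
def treeWeight {X : Type*} [Fintype X] (r : X × X → ℝ) (x : X) (t : X → X) : ℝ :=
  ∏ y ∈ Finset.univ.filter (fun y => y ≠ x), r (y, t y)

/-- The conditioned rooted spanning-tree polynomial `τ_x^{∖A ∥B}`: the sum of weights of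
rooted spanning trees with root `x` avoiding all edges of `A` and containing all edges of `B`. -/
def tau {X : Type*} [Fintype X] (r : X × X → ℝ) (x : X) (A B : Set (X × X)) : ℝ :=
  ∑ t : X → X,
    if IsRootedTree x t ∧ treeEdges x t ∩ A = ∅ ∧ B ⊆ treeEdges x t
    then treeWeight r x t else 0

/-- Irreducibility: between any two distinct vertices there is a directed path of
present (positive-rate) edges. -/
def Irreducible' {X : Type*} (r : X × X → ℝ) : Prop :=
  ∀ x y : X, x ≠ y → ∃ (n : ℕ) (f : ℕ → X),
    f 0 = x ∧ f n = y ∧ ∀ i < n, 0 < r (f i, f (i + 1))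

/-- The rate function with the pinned rates `r(a,b) = p` and `r(b,a) = m` substituted. -/
def ratePM {X : Type*} (r : X × X → ℝ) (a b : X) (p m : ℝ) : X × X → ℝ :=
  fun e => if e = (a, b) then p else if e = (b, a) then m else r e

/-- The stationary current through the ordered pair `(u,v)`:
`(r(u,v) τ_u − r(v,u) τ_v) / Σ_x τ_x`. -/
def current {X : Type*} [Fintype X] (r : X × X → ℝ) (u v : X) : ℝ :=
  (r (u, v) * tau r u ∅ ∅ - r (v, u) * tau r v ∅ ∅) / ∑ x, tau r x ∅ ∅

lemma reach_aux {X : Type*} (f g : X → X) (v : X) (h : ∀ y, y ≠ v → f y = g y) (n : ℕ) :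
    ∀ y, f^[n] y = v → ∃ k, g^[k] y = v := by
  induction n with
  | zero => intro y hy; exact ⟨0, hy⟩
  | succ n ih =>
    intro y hy
    by_cases hyv : y = v
    · exact ⟨0, hyv⟩
    · rw [Function.iterate_succ_apply] at hy
      obtain ⟨k, hk⟩ := ih _ hy
      refine ⟨k + 1, ?_⟩
      rw [Function.iterate_succ_apply, ← h y hyv, hk]

lemma tree_update_iff {X : Type*} (f : X → X) (v : X) :
    IsRootedTree v (Function.update f v v) ↔ ∀ y, ∃ n : ℕ, f^[n] y = v := by
  have h1 : ∀ y, y ≠ v → Function.update f v v y = f y := fun y hy => by simp [hy]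
  constructor
  · rintro ⟨-, h⟩ y
    obtain ⟨n, hn⟩ := h y
    exact reach_aux _ _ v h1 n y hn
  · intro h
    refine ⟨by simp, fun y => ?_⟩
    obtain ⟨n, hn⟩ := h y
    exact reach_aux _ _ v (fun y hy => (h1 y hy).symm) n y hn

lemma rate_mul_tau {X : Type*} [Fintype X] (r : X × X → ℝ) (v u : X) :
    r (v, u) * tau r v ∅ ∅ =
      ∑ f : X → X, if f v = u ∧ ∀ y, ∃ n : ℕ, f^[n] y = v then ∏ y, r (y, f y) else 0 := by
  unfold tau
  simp only [Set.inter_empty, Set.empty_subset, and_true, true_and]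
  rw [← Finset.sum_filter, ← Finset.sum_filter, Finset.mul_sum]
  refine Finset.sum_bij' (fun t _ => Function.update t v u) (fun f _ => Function.update f v v)
    ?_ ?_ ?_ ?_ ?_
  · intro t ht
    simp only [Finset.mem_filter, Finset.mem_univ, true_and] at ht ⊢
    refine ⟨by simp, ?_⟩
    rw [← tree_update_iff]
    have : Function.update (Function.update t v u) v v = t := by
      funext y
      by_cases hy : y = v
      · subst hy; simp [ht.1]
      · simp [hy]
    rw [this]; exact ht
  · intro f hf
    simp only [Finset.mem_filter, Finset.mem_univ, true_and] at hf ⊢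
    rw [tree_update_iff]; exact hf.2
  · intro t ht
    simp only [Finset.mem_filter, Finset.mem_univ, true_and] at ht
    funext y
    by_cases hy : y = v
    · subst hy; simp [ht.1]
    · simp [hy]
  · intro f hf
    simp only [Finset.mem_filter, Finset.mem_univ, true_and] at hf
    funext y
    by_cases hy : y = v
    · subst hy; simp [hf.1]
    · simp [hy]
  · intro t ht
    unfold treeWeight
    rw [← Finset.mul_prod_erase Finset.univ _ (Finset.mem_univ v)]
    simp only [Function.update_self]
    congr 1
    apply Finset.prod_congr
    · ext y; simp
    · intro y hy
      have : y ≠ v := by simpa using hy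
      simp [this]

lemma reach_pred_iff {X : Type*} (f : X → X) (u v : X) :
    (f v = u ∧ ∀ y, ∃ n : ℕ, f^[n] y = v) ↔
      ((∀ y, ∃ n : ℕ, f^[n] y = u) ∧ f v = u ∧ v ∈ Function.periodicPts f) := by
  constructor
  · rintro ⟨h1, h2⟩
    refine ⟨fun y => ?_, h1, ?_⟩
    · obtain ⟨n, hn⟩ := h2 y
      exact ⟨n + 1, by rw [Function.iterate_succ_apply', hn, h1]⟩
    · obtain ⟨n, hn⟩ := h2 u
      refine ⟨n + 1, Nat.succ_pos n, ?_⟩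
      show f^[n+1] v = v
      rw [Function.iterate_succ_apply, h1, hn]
  · rintro ⟨h1, h2, n, hn, hp⟩
    refine ⟨h2, fun y => ?_⟩
    obtain ⟨k, hk⟩ := h1 y
    obtain ⟨n, rfl⟩ : ∃ n', n = n' + 1 := ⟨n - 1, by omega⟩
    refine ⟨n + k, ?_⟩
    have hp' : f^[n+1] v = v := hp
    rw [Function.iterate_succ_apply, h2] at hp'
    rw [Function.iterate_add_apply, hk, hp']

/-- Markov chain tree theorem (stationarity). -/
lemma balance {X : Type*} [Fintype X] (r : X × X → ℝ) (u : X) :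
    ∑ v, r (u, v) * tau r u ∅ ∅ = ∑ v, r (v, u) * tau r v ∅ ∅ := by
  simp only [rate_mul_tau]
  rw [Finset.sum_comm]
  conv_rhs => rw [Finset.sum_comm]
  refine Finset.sum_congr rfl fun f _ => ?_
  simp only [reach_pred_iff f u]
  by_cases h : ∀ y, ∃ n : ℕ, f^[n] y = u
  · obtain ⟨n, hn⟩ := h (f u)
    have hn' : f^[n+1] u = u := by rw [Function.iterate_succ_apply, hn]
    have hv : f (f^[n] u) = u := by rw [← Function.iterate_succ_apply' f, hn']
    have hvp : f^[n] u ∈ Function.periodicPts f := by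
      refine ⟨n + 1, Nat.succ_pos n, ?_⟩
      show f^[n+1] (f^[n] u) = f^[n] u
      rw [← Function.iterate_add_apply, add_comm, Function.iterate_add_apply, hn']
    have key : ∀ v, (f v = u ∧ v ∈ Function.periodicPts f) ↔ f^[n] u = v := by
      intro v
      constructor
      · rintro ⟨h1, h2⟩
        exact (Function.bijOn_periodicPts f).injOn hvp h2 (hv.trans h1.symm)
      · rintro rfl; exact ⟨hv, hvp⟩
    simp only [key, h, implies_true, true_and, and_true]
    simp
  · simp [h]

lemma harmonic_const {X : Type*} [Fintype X] (r : X × X → ℝ) (hr : ∀ e, 0 ≤ r e)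
    (hirr : Irreducible' r) (g : X → ℝ) (hg : ∀ x, ∑ v, r (x, v) * (g x - g v) = 0) (u v : X) :
    g u = g v := by
  obtain ⟨x0, -, hx0⟩ := Finset.exists_max_image Finset.univ g ⟨u, Finset.mem_univ u⟩
  have hmax : ∀ y, g y ≤ g x0 := fun y => hx0 y (Finset.mem_univ y)
  have main : ∀ y, g y = g x0 := by
    intro y
    by_cases hy : x0 = y
    · rw [hy]
    obtain ⟨n, f, h0, hn, hf⟩ := hirr x0 y hy
    have : ∀ i, i ≤ n → g (f i) = g x0 := by
      intro i
      induction i with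
      | zero => intro _; rw [h0]
      | succ i ih =>
        intro hi
        have e := ih (by omega)
        have hs := hg (f i)
        rw [Finset.sum_eq_zero_iff_of_nonneg] at hs
        · have h1 := hs (f (i+1)) (Finset.mem_univ _)
          have h2 := hf i (by omega)
          rcases mul_eq_zero.mp h1 with h | h
          · exact absurd h h2.ne'
          · linarith
        · intro z _
          exact mul_nonneg (hr _) (by rw [e]; linarith [hmax z])
    rw [← hn]; exact this n le_rfl
  rw [main u, main v]

lemma reduced_balance {X : Type*} [Fintype X] (r : X × X → ℝ) (a b : X) (hab : a ≠ b)
    (p m : ℝ) (ρ : X → ℝ)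
    (h : ∀ x, ∑ v, ratePM r a b p m (x, v) * ρ x = ∑ v, ratePM r a b p m (v, x) * ρ v) (x : X) :
    ∑ v, (ratePM r a b 0 0 (x, v) * ρ x - ratePM r a b 0 0 (v, x) * ρ v) =
      (p * ρ a - m * ρ b) * ((if x = b then 1 else 0) - (if x = a then 1 else 0)) := by
  have hR : ∀ y z, ratePM r a b 0 0 (y, z) = ratePM r a b p m (y, z)
      - (if y = a then (if z = b then p else 0) else 0)
      - (if y = b then (if z = a then m else 0) else 0) := by
    intro y z
    unfold ratePM
    simp only [Prod.mk.injEq]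
    by_cases h1 : y = a <;> by_cases h2 : y = b <;> by_cases h3 : z = a <;>
      by_cases h4 : z = b <;> simp_all
  have hx := h x
  simp only [hR, sub_mul, Finset.sum_sub_distrib, hx]
  by_cases h1 : x = a
  · have h2 : x ≠ b := h1 ▸ hab
    subst h1
    simp [hab, ite_mul]
    try ring
  · by_cases h2 : x = b
    · subst h2
      simp [h1, ite_mul]
      try ring
    · simp [h1, h2]

lemma current_prop {X : Type*} [Fintype X] (r0 : X × X → ℝ) (hr : ∀ e, 0 ≤ r0 e)
    (hirr : Irreducible' r0) (π : X → ℝ) (hπ : ∀ x, 0 < π x)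
    (hdb : ∀ u v, π u * r0 (u, v) = π v * r0 (v, u))
    (G : X → ℝ) (hG : ∀ x, ∑ v, (r0 (x, v) * G x - r0 (v, x) * G v) = 0) (u v : X) :
    r0 (u, v) * G u - r0 (v, u) * G v = 0 := by
  have e : ∀ x v, r0 (x, v) * G x - r0 (v, x) * G v
      = π x * (r0 (x, v) * (G x / π x - G v / π v)) := by
    intro x v
    have h1 := (hπ x).ne'
    have h2 := (hπ v).ne'
    have := hdb x v
    have h3 : G x = π x * (G x / π x) := by field_simp
    have h4 : G v = π v * (G v / π v) := by field_simp
    generalize G x / π x = A at *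
    generalize G v / π v = B at *
    rw [h3, h4]
    linear_combination B * this
  have hc := harmonic_const r0 hr hirr (fun x => G x / π x) (fun x => by
    have := hG x
    simp only [e] at this
    rw [← Finset.mul_sum] at this
    exact (mul_eq_zero.mp this).resolve_left (hπ x).ne') u v
  rw [e]
  rw [hc]; ring

theorem stmt_15 {X : Type*} [Fintype X] (r : X × X → ℝ) (a b : X) (hab : a ≠ b)
    (hr : ∀ e, e ≠ (a, b) → e ≠ (b, a) → 0 ≤ r e)
    (hirr : Irreducible' (ratePM r a b 0 0))
    (hdb : ∃ π : X → ℝ, (∀ x, 0 < π x) ∧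
      ∀ u v : X, π u * ratePM r a b 0 0 (u, v) = π v * ratePM r a b 0 0 (v, u))
    (u v : X) (huv : u ≠ v) :
    ∃ lam1 : ℝ, ∀ p m : ℝ, 0 ≤ p → 0 ≤ m →
      current (ratePM r a b p m) u v = lam1 * current (ratePM r a b p m) a b := by
  obtain ⟨π, hπ, hdb⟩ := hdb
  by_cases h1 : (u, v) = (a, b)
  · obtain ⟨rfl, rfl⟩ := Prod.mk.inj h1
    exact ⟨1, fun p m _ _ => by rw [one_mul]⟩
  by_cases h2 : (u, v) = (b, a)
  · obtain ⟨rfl, rfl⟩ := Prod.mk.inj h2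
    exact ⟨-1, fun p m _ _ => by unfold current; ring⟩
  have h1' : (v, u) ≠ (b, a) := fun h => h1 (by
    obtain ⟨rfl, rfl⟩ := Prod.mk.inj h; rfl)
  have h2' : (v, u) ≠ (a, b) := fun h => h2 (by
    obtain ⟨rfl, rfl⟩ := Prod.mk.inj h; rfl)
  have hr0 : ∀ e, 0 ≤ ratePM r a b 0 0 e := by
    intro e
    unfold ratePM
    split_ifs with g1 g2
    · exact le_rfl
    · exact le_rfl
    · exact hr e g1 g2
  have huvR : ∀ p m, ratePM r a b p m (u, v) = ratePM r a b 0 0 (u, v) := by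
    intro p m; simp only [ratePM, if_neg h1, if_neg h2]
  have hvuR : ∀ p m, ratePM r a b p m (v, u) = ratePM r a b 0 0 (v, u) := by
    intro p m; simp only [ratePM, if_neg h1', if_neg h2']
  have habR : ∀ p m, ratePM r a b p m (a, b) = p := by
    intro p m; simp [ratePM]
  have hbaR : ∀ p m, ratePM r a b p m (b, a) = m := by
    intro p m; simp [ratePM, hab, hab.symm]
  -- unnormalised currents
  let T : ℝ → ℝ → X → ℝ := fun p m x => tau (ratePM r a b p m) x ∅ ∅
  let J : ℝ → ℝ → ℝ := fun p m => p * T p m a - m * T p m b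
  let I : ℝ → ℝ → ℝ := fun p m =>
    ratePM r a b 0 0 (u, v) * T p m u - ratePM r a b 0 0 (v, u) * T p m v
  have hbal : ∀ p m x, ∑ w, (ratePM r a b 0 0 (x, w) * T p m x
      - ratePM r a b 0 0 (w, x) * T p m w) =
      J p m * ((if x = b then 1 else 0) - (if x = a then 1 else 0)) := fun p m x =>
    reduced_balance r a b hab p m (T p m) (fun x => balance (ratePM r a b p m) x) x
  have key : ∀ p m p' m', J p' m' * I p m = J p m * I p' m' := by
    intro p m p' m'
    have := current_prop (ratePM r a b 0 0) hr0 hirr π hπ hdb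
      (fun x => J p' m' * T p m x - J p m * T p' m' x) (fun x => by
        have e1 := hbal p m x
        have e2 := hbal p' m' x
        have e3 : ∀ w, ratePM r a b 0 0 (x, w) * (J p' m' * T p m x - J p m * T p' m' x)
            - ratePM r a b 0 0 (w, x) * (J p' m' * T p m w - J p m * T p' m' w)
            = J p' m' * (ratePM r a b 0 0 (x, w) * T p m x - ratePM r a b 0 0 (w, x) * T p m w)
            - J p m * (ratePM r a b 0 0 (x, w) * T p' m' x
              - ratePM r a b 0 0 (w, x) * T p' m' w) := fun w => by ring
        simp only [e3]
        rw [Finset.sum_sub_distrib, ← Finset.mul_sum, ← Finset.mul_sum, e1, e2]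
        ring) u v
    simp only [I]
    linear_combination this
  have zero : ∀ p m, J p m = 0 → I p m = 0 := by
    intro p m hJ
    exact current_prop (ratePM r a b 0 0) hr0 hirr π hπ hdb (T p m)
      (fun x => by rw [hbal, hJ, zero_mul]) u v
  have fin : ∃ lam : ℝ, ∀ p m, I p m = lam * J p m := by
    by_cases hex : ∃ p m, J p m ≠ 0
    · obtain ⟨p0, m0, h0⟩ := hex
      refine ⟨I p0 m0 / J p0 m0, fun p m => ?_⟩
      have := key p m p0 m0
      field_simp
      linear_combination this
    · push Not at hex
      exact ⟨0, fun p m => by rw [zero p m (hex p m), zero_mul]⟩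
  obtain ⟨lam, hlam⟩ := fin
  refine ⟨lam, fun p m _ _ => ?_⟩
  unfold current
  rw [huvR, hvuR, habR, hbaR, ← mul_div_assoc]
  congr 1
  exact hlam p m
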